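/- Let (P,p,k) be a commutative noetherian local ring and P → Q a homomorphism of commutative rings. The following conditions are equivalent: (i) the P-algebra Q is Frobenius; (ii) the P'-algebra Q' = P' ⊗_P Q is Frobenius for every local ring P' and every ring homomorphism P → P'; (iii) the P-module Q is finite free and the ring k(q) ⊗_P Q is Gorenstein for every prime ideal q of P; (iv) the P-module Q is finite free and the ring Q/pQ is Gorenstein. -/

import Mathlib

open CategoryTheory TensorProduct

noncomputable section

/-- `R` has finite injective dimension as a module over itself, expressed by the
eventual vanishing of `Ext^i(-, R)`. -/
def HasFiniteSelfInjDim (R : Type) [CommRing R] : Prop :=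
  ∃ n : ℕ, ∀ (M : ModuleCat R) (i : ℕ), n < i →
    Limits.IsZero (((Ext R (ModuleCat R) i).obj (Opposite.op M)).obj (ModuleCat.of R R))

/-- A commutative ring is Gorenstein if each of its localizations at primes has finite
injective dimension over itself. -/
def IsGorensteinRing (S : Type) [CommRing S] : Prop :=
  ∀ (q : Ideal S) (hq : q.IsPrime),
    letI := hq
    HasFiniteSelfInjDim (Localization.AtPrime q)

/-- The `P`-algebra `Q` is Frobenius: `Q` is a finite free `P`-module and
`Hom_P(Q, P) ≅ Q` as `Q`-modules, where `Hom_P(Q, P)` carries the `Q`-action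
`(x • φ) y = φ (x * y)`; equivalently, the map `x ↦ φ(x * -)` is bijective for
some `φ : Q →ₗ[P] P`. -/
def IsFrobeniusAlgebra (P Q : Type) [CommRing P] [CommRing Q] [Algebra P Q] : Prop :=
  Module.Finite P Q ∧ Module.Free P Q ∧
  ∃ φ : Q →ₗ[P] P, Function.Bijective fun x : Q => φ ∘ₗ LinearMap.mulLeft P x

/-- The module structure `(x • φ) y = φ (x * y)` on `Hom_k(A, k)` for a commutative
`k`-algebra `A`. -/
instance dualModule (k A : Type) [CommRing k] [CommRing A] [Algebra k A] :
    Module A (A →ₗ[k] k) where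
  smul a f := f ∘ₗ LinearMap.mulLeft k a
  one_smul f := by
    ext x
    show f (1 * x) = f x
    rw [one_mul]
  mul_smul a b f := by
    ext x
    show f ((a * b) * x) = f (b * (a * x))
    congr 1; ring
  smul_zero a := by ext x; rfl
  smul_add a f g := by ext x; rfl
  add_smul a b f := by
    ext x
    show f ((a + b) * x) = f (a * x) + f (b * x)
    rw [add_mul, map_add]
  zero_smul f := by
    ext x
    show f (0 * x) = 0
    rw [zero_mul, map_zero]

open Module

variable {R : Type} [CommRing R]

/-- The derived-functor `Ext` and the derived-category `Ext` vanish simultaneously. -/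
lemma isZero_ext_succ_iff_subsingleton (M Y : ModuleCat R) (n : ℕ) :
    Limits.IsZero (((Ext R (ModuleCat R) (n + 1)).obj (Opposite.op M)).obj Y) ↔
      Subsingleton (Abelian.Ext M Y (n + 1)) := by
  let K := projectiveResolution M
  rw [(K.isoExt (R := R) (n + 1) Y).isZero_iff,
    ← HomologicalComplex.exactAt_iff_isZero_homology,
    HomologicalComplex.exactAt_iff' _ n (n + 1) (n + 2) (by simp) (by simp),
    ShortComplex.moduleCat_exact_iff]
  constructor
  · intro h
    refine subsingleton_of_forall_eq 0 fun α ↦ ?_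
    obtain ⟨f, hf, rfl⟩ := K.extMk_surjective α (n + 2) rfl
    exact (K.extMk_eq_zero_iff f (n + 2) rfl hf n rfl).2 (h f hf)
  · intro h f hf
    exact (K.extMk_eq_zero_iff f (n + 2) rfl hf n rfl).1 (Subsingleton.elim _ _)

lemma hasFiniteSelfInjDim_of_injective [Module.Injective R R] : HasFiniteSelfInjDim R := by
  have := Module.injective_object_of_injective_module R R
  refine ⟨0, fun M i hi ↦ ?_⟩
  obtain ⟨n, rfl⟩ := Nat.exists_eq_add_of_lt hi
  rw [zero_add, isZero_ext_succ_iff_subsingleton]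
  exact HasInjectiveDimensionLT.subsingleton (ModuleCat.of R R) 1 (n + 1) (by omega) M

/-- A linear form is a Frobenius form if and only if its Gram matrix is invertible. -/
lemma bijective_comp_mulLeft_iff {P Q ι : Type} [CommRing P] [CommRing Q] [Algebra P Q]
    [Fintype ι] [DecidableEq ι] (b : Basis ι P Q) (φ : Q →ₗ[P] P) :
    (Function.Bijective fun x : Q => φ ∘ₗ LinearMap.mulLeft P x) ↔
      IsUnit (Matrix.of fun i j ↦ φ (b i * b j)).det := by
  let L : Q →ₗ[P] Dual P Q := (LinearMap.mul P Q).compr₂ φ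
  have hL : LinearMap.toMatrix b b.dualBasis L = Matrix.of fun i j ↦ φ (b i * b j) := by
    ext i j
    simp [LinearMap.toMatrix_apply, L, mul_comm]
  rw [← hL]
  change Function.Bijective L ↔ _
  constructor
  · intro h
    exact (LinearEquiv.ofBijective L h).isUnit_det b b.dualBasis
  · intro h
    exact (LinearEquiv.ofIsUnitDet h).bijective

section Transfer

variable {P P' Q Q' ι : Type} [CommRing P] [CommRing P'] [CommRing Q] [CommRing Q']
  [Algebra P Q] [Algebra P' Q'] [Fintype ι]

lemma apply_map_of_forall_basis (f : P →+* P') (g : Q →+* Q')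
    (hg : ∀ (c : P) (x : Q), g (c • x) = f c • g x) (b : Basis ι P Q)
    (φ : Q →ₗ[P] P) (φ' : Q' →ₗ[P'] P') (h : ∀ i, φ' (g (b i)) = f (φ (b i))) (x : Q) :
    φ' (g x) = f (φ x) := by
  rw [← b.sum_repr x]
  simp only [map_sum, hg, map_smul, h, smul_eq_mul, map_mul]

lemma det_gram_map [DecidableEq ι] (f : P →+* P') (g : Q →+* Q')
    (hg : ∀ (c : P) (x : Q), g (c • x) = f c • g x) (b : Basis ι P Q) (b' : Basis ι P' Q')
    (hb : ∀ i, b' i = g (b i))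
    (φ : Q →ₗ[P] P) (φ' : Q' →ₗ[P'] P') (h : ∀ i, φ' (b' i) = f (φ (b i))) :
    (Matrix.of fun i j ↦ φ' (b' i * b' j)).det =
      f (Matrix.of fun i j ↦ φ (b i * b j)).det := by
  rw [RingHom.map_det]
  congr 1
  ext i j
  simp [hb, ← map_mul, apply_map_of_forall_basis f g hg b φ φ' (fun i ↦ by rw [← hb, h])]

/-- Frobenius algebras are stable under base change. -/
lemma IsFrobeniusAlgebra.of_basis_map (f : P →+* P') (g : Q →+* Q')
    (hg : ∀ (c : P) (x : Q), g (c • x) = f c • g x) (b : Basis ι P Q) (b' : Basis ι P' Q')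
    (hb : ∀ i, b' i = g (b i)) (hQ : IsFrobeniusAlgebra P Q) : IsFrobeniusAlgebra P' Q' := by
  classical
  obtain ⟨-, -, φ, hφ⟩ := hQ
  refine ⟨.of_basis b', .of_basis b', b'.constr P' fun i ↦ f (φ (b i)), ?_⟩
  rw [bijective_comp_mulLeft_iff b']
  rw [bijective_comp_mulLeft_iff b] at hφ
  rw [det_gram_map f g hg b b' hb φ _ (by simp)]
  exact hφ.map f

/-- The Frobenius property descends along surjective local homomorphisms. -/
lemma IsFrobeniusAlgebra.of_surjective (f : P →+* P') [IsLocalHom f] (hf : Function.Surjective f)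
    (g : Q →+* Q') (hg : ∀ (c : P) (x : Q), g (c • x) = f c • g x)
    (b : Basis ι P Q) (b' : Basis ι P' Q') (hb : ∀ i, b' i = g (b i))
    (hQ : IsFrobeniusAlgebra P' Q') : IsFrobeniusAlgebra P Q := by
  classical
  obtain ⟨-, -, φ, hφ⟩ := hQ
  choose c hc using fun i ↦ hf (φ (b' i))
  refine ⟨.of_basis b, .of_basis b, b.constr P c, ?_⟩
  rw [bijective_comp_mulLeft_iff b'] at hφ
  rw [bijective_comp_mulLeft_iff b]
  rw [det_gram_map f g hg b b' hb (b.constr P c) φ (by simp [hc])] at hφ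
  exact (isUnit_map_iff f _).1 hφ

end Transfer

section BaseChange

variable {P Q : Type} [CommRing P] [CommRing Q] [Algebra P Q]

lemma IsFrobeniusAlgebra.baseChange (P' : Type) [CommRing P'] [Algebra P P']
    (h : IsFrobeniusAlgebra P Q) : IsFrobeniusAlgebra P' (P' ⊗[P] Q) := by
  have := h.1
  have := h.2.1
  let b := Module.Free.chooseBasis P Q
  exact h.of_basis_map (algebraMap P P')
    (Algebra.TensorProduct.includeRight : Q →ₐ[P] P' ⊗[P] Q).toRingHom
    (fun c x ↦ by simp [Algebra.algebraMap_eq_smul_one, smul_tmul']) b (b.baseChange P')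
    (fun i ↦ by simp)

lemma IsFrobeniusAlgebra.of_baseChange_of_surjective [IsLocalRing P] {P' : Type} [CommRing P']
    [Nontrivial P'] [Algebra P P'] [Module.Finite P Q] [Module.Free P Q]
    (hf : Function.Surjective (algebraMap P P')) (h : IsFrobeniusAlgebra P' (P' ⊗[P] Q)) :
    IsFrobeniusAlgebra P Q := by
  let b := Module.Free.chooseBasis P Q
  have := IsLocalHom.of_surjective (algebraMap P P') hf
  exact h.of_surjective (algebraMap P P') hf
    (Algebra.TensorProduct.includeRight : Q →ₐ[P] P' ⊗[P] Q).toRingHom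
    (fun c x ↦ by simp [Algebra.algebraMap_eq_smul_one, smul_tmul']) b (b.baseChange P')
    (fun i ↦ by simp)

end BaseChange

section Field

variable {F A : Type} [Field F] [CommRing A] [Algebra F A]

lemma isFrobeniusAlgebra_iff_exists_nondegenerate [Module.Finite F A] :
    IsFrobeniusAlgebra F A ↔ ∃ φ : A →ₗ[F] F, ∀ x, (∀ y, φ (x * y) = 0) → x = 0 := by
  have key (φ : A →ₗ[F] F) : (Function.Bijective fun x : A => φ ∘ₗ LinearMap.mulLeft F x) ↔
      ∀ x, (∀ y, φ (x * y) = 0) → x = 0 := by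
    let L : A →ₗ[F] Dual F A := (LinearMap.mul F A).compr₂ φ
    change Function.Bijective L ↔ _
    have : Function.Bijective L ↔ Function.Injective L :=
      ⟨fun h ↦ h.1, fun h ↦ ⟨h, (LinearMap.injective_iff_surjective_of_finrank_eq_finrank
        (Subspace.dual_finrank_eq).symm).1 h⟩⟩
    rw [this, injective_iff_map_eq_zero]
    simp [LinearMap.ext_iff, L]
  simp only [IsFrobeniusAlgebra, key]
  exact ⟨fun h ↦ h.2.2, fun h ↦ ⟨inferInstance, inferInstance, h⟩⟩

lemma IsFrobeniusAlgebra.injective (h : IsFrobeniusAlgebra F A) : Module.Injective A A := by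
  obtain ⟨-, -, φ, hφ⟩ := h
  refine Module.Baer.injective fun I g ↦ ?_
  obtain ⟨ψ, hψ⟩ := LinearMap.exists_extend (p := I.restrictScalars F)
    (φ ∘ₗ g.restrictScalars F : I.restrictScalars F →ₗ[F] F)
  obtain ⟨s, hs⟩ := hφ.2 ψ
  refine ⟨LinearMap.mulLeft A s, fun x hx ↦ hφ.1 (LinearMap.ext fun t ↦ ?_)⟩
  have h1 := LinearMap.congr_fun hψ ⟨t * x, I.mul_mem_left t hx⟩
  have h2 : g ⟨t * x, I.mul_mem_left t hx⟩ = t * g ⟨x, hx⟩ := g.map_smul t ⟨x, hx⟩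
  have h3 := LinearMap.congr_fun hs (t * x)
  simp only [LinearMap.comp_apply, LinearMap.mulLeft_apply, Submodule.subtype_apply] at h1 h3 ⊢
  rw [show s * x * t = s * (t * x) by ring, h3, h1, mul_comm _ t]
  exact congrArg φ h2

lemma IsFrobeniusAlgebra.isGorensteinRing (h : IsFrobeniusAlgebra F A) : IsGorensteinRing A := by
  have := h.injective
  have := h.1
  have : IsNoetherianRing A := IsNoetherianRing.of_finite F A
  intro q hq
  have := Module.injective_of_isLocalizedModule q.primeCompl (Rₛ := Localization.AtPrime q)
    (Algebra.linearMap A (Localization.AtPrime q))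
  exact hasFiniteSelfInjDim_of_injective

end Field

section LocalArtinian

variable [IsArtinianRing R] [IsLocalRing R]

lemma exists_injective_residue_of_ne_bot {I : Ideal R} (hI : I ≠ ⊥) :
    ∃ f : (R ⧸ IsLocalRing.maximalIdeal R) →ₗ[R] R, Function.Injective f ∧ f 1 ∈ I := by
  have : Nontrivial I := Submodule.nontrivial_iff_ne_bot.2 hI
  obtain ⟨p, hp⟩ := associatedPrimes.nonempty R I
  obtain ⟨hp, w, hw⟩ := isAssociatedPrime_iff.1 hp
  obtain rfl := IsLocalRing.eq_maximalIdeal (IsArtinianRing.isMaximal_of_isPrime p)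
  have key : IsLocalRing.maximalIdeal R = LinearMap.ker (LinearMap.toSpanSingleton R R w) := by
    rw [hw]
    ext r
    simp [Submodule.mem_colon_singleton, Subtype.ext_iff]
  refine ⟨Submodule.liftQ _ (LinearMap.toSpanSingleton R R w) key.le, ?_, ?_⟩
  · rw [← LinearMap.ker_eq_bot, Submodule.ker_liftQ_eq_bot' _ _ key]
  · change (1 : R) • (w : R) ∈ I
    simp

lemma subsingleton_ext_of_subsingleton_ext_succ {n : ℕ}
    (H : ∀ (N : Type) [AddCommGroup N] [Module R N] [Module.Finite R N],
      Subsingleton (Abelian.Ext (ModuleCat.of R N) (ModuleCat.of R R) (n + 2)))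
    (N : Type) [AddCommGroup N] [Module R N] [hN : Module.Finite R N] :
    Subsingleton (Abelian.Ext (ModuleCat.of R N) (ModuleCat.of R R) (n + 1)) := by
  induction hN using IsNoetherianRing.induction_on_isQuotientEquivQuotientPrime R with
  | subsingleton N =>
    have : Projective (ModuleCat.of R N) :=
      (ModuleCat.isZero_of_subsingleton (ModuleCat.of R N)).projective
    exact subsingleton_of_forall_eq 0 Abelian.Ext.eq_zero_of_projective
  | quotient N p e =>
    obtain ⟨p, hp⟩ := p
    obtain rfl := IsLocalRing.eq_maximalIdeal (IsArtinianRing.isMaximal_of_isPrime p)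
    obtain ⟨f, hf, -⟩ := exists_injective_residue_of_ne_bot (R := R) top_ne_bot
    have hS : (ModuleCat.shortComplexOfCompEqZero (f ∘ₗ e.toLinearMap)
        (LinearMap.range (f ∘ₗ e.toLinearMap)).mkQ
        (LinearMap.range_mkQ_comp _)).ShortExact :=
      ModuleCat.shortComplex_shortExact _ (LinearMap.exact_map_mkQ_range _)
        (hf.comp e.injective) (Submodule.mkQ_surjective _)
    have : Projective (ModuleCat.of R R) := ModuleCat.projective_of_categoryTheory_projective _
    refine subsingleton_of_forall_eq 0 fun x ↦ ?_
    have := H (R ⧸ LinearMap.range (f ∘ₗ e.toLinearMap))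
    obtain ⟨y, rfl⟩ := Abelian.Ext.contravariant_sequence_exact₁ hS _ x
      (n₁ := n + 2) (by omega) (Subsingleton.elim _ _)
    rw [Abelian.Ext.eq_zero_of_projective y, Abelian.Ext.comp_zero]
  | exact N₁ N₂ N₃ f g hf hg hfg h₁ h₃ =>
    have hS : (ModuleCat.shortComplexOfCompEqZero f g hfg.linearMap_comp_eq_zero).ShortExact :=
      ModuleCat.shortComplex_shortExact _ hfg hf hg
    refine subsingleton_of_forall_eq 0 fun x ↦ ?_
    obtain ⟨y, rfl⟩ := Abelian.Ext.contravariant_sequence_exact₂ hS _ x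
      (Subsingleton.elim (h := h₁) _ _)
    rw [Subsingleton.elim (h := h₃) y 0, Abelian.Ext.comp_zero]

/-- An artinian local ring of finite self-injective dimension is self-injective. -/
lemma HasFiniteSelfInjDim.baer (h : HasFiniteSelfInjDim R) : Module.Baer R R := by
  obtain ⟨n, hn⟩ := h
  have key (N : Type) [AddCommGroup N] [Module R N] [Module.Finite R N] :
      Subsingleton (Abelian.Ext (ModuleCat.of R N) (ModuleCat.of R R) 1) := by
    replace hn (N : Type) [AddCommGroup N] [Module R N] [Module.Finite R N] :
        Subsingleton (Abelian.Ext (ModuleCat.of R N) (ModuleCat.of R R) (n + 1)) :=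
      (isZero_ext_succ_iff_subsingleton _ _ n).1 (hn (ModuleCat.of R N) (n + 1) n.lt_succ_self)
    induction n with
    | zero => exact hn N
    | succ n ih => exact ih fun N ↦ subsingleton_ext_of_subsingleton_ext_succ hn N
  intro I g
  have hS : (ModuleCat.shortComplexOfCompEqZero I.subtype I.mkQ
      (LinearMap.exact_subtype_mkQ I).linearMap_comp_eq_zero).ShortExact :=
    ModuleCat.shortComplex_shortExact _ (LinearMap.exact_subtype_mkQ I)
      I.injective_subtype I.mkQ_surjective
  have := key (R ⧸ I)
  obtain ⟨y, hy⟩ := Abelian.Ext.contravariant_sequence_exact₁ hS _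
    (Abelian.Ext.mk₀ (ModuleCat.ofHom g)) (n₁ := 1) rfl (Subsingleton.elim _ _)
  obtain ⟨y, rfl⟩ := (Abelian.Ext.mk₀_bijective _ _).2 y
  rw [Abelian.Ext.mk₀_comp_mk₀] at hy
  refine ⟨y.hom, fun x hx ↦ ?_⟩
  exact LinearMap.congr_fun (congrArg ModuleCat.Hom.hom ((Abelian.Ext.mk₀_bijective _ _).1 hy))
    ⟨x, hx⟩

lemma HasFiniteSelfInjDim.exists_nondegenerate {F : Type} [Field F] [Algebra F R]
    (h : HasFiniteSelfInjDim R) :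
    ∃ φ : R →ₗ[F] F, ∀ x, (∀ y, φ (x * y) = 0) → x = 0 := by
  obtain ⟨f, hf, -⟩ := exists_injective_residue_of_ne_bot (R := R) top_ne_bot
  have hf1 : f 1 ≠ 0 := (map_ne_zero_iff f hf).2 one_ne_zero
  obtain ⟨φ, hφ⟩ : ∃ φ : Dual F R, φ (f 1) ≠ 0 := by
    by_contra! hc
    exact hf1 ((Module.forall_dual_apply_eq_zero_iff F _).1 hc)
  refine ⟨φ, fun x hx ↦ ?_⟩
  by_contra hx0
  obtain ⟨g, hg, hgx⟩ := exists_injective_residue_of_ne_bot (R := R)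
    (I := Ideal.span {x}) (by simpa [Ideal.span_singleton_eq_bot] using hx0)
  obtain ⟨s, hs⟩ := Ideal.mem_span_singleton.1 hgx
  obtain ⟨t, ht⟩ := h.baer.extension_property g hg f
  apply hφ
  have : f 1 = x * (s * t 1) := by
    rw [← ht, LinearMap.comp_apply, ← mul_assoc, ← hs, ← smul_eq_mul, ← map_smul, smul_eq_mul,
      mul_one]
  rw [this, hx]

end LocalArtinian

lemma IsGorensteinRing.isFrobeniusAlgebra {F A : Type} [Field F] [CommRing A] [Algebra F A]
    [Module.Finite F A] (h : IsGorensteinRing A) : IsFrobeniusAlgebra F A := by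
  classical
  rw [isFrobeniusAlgebra_iff_exists_nondegenerate]
  have : IsArtinianRing A := IsArtinianRing.of_finite F A
  have (p : PrimeSpectrum A) : IsArtinianRing (Localization.AtPrime p.asIdeal) :=
    IsArtinianRing.localization_artinian p.asIdeal.primeCompl _
  choose φ hφ using fun p : PrimeSpectrum A ↦ (h p.asIdeal p.isPrime).exists_nondegenerate (F := F)
  have := Fintype.ofFinite (PrimeSpectrum A)
  refine ⟨∑ p, φ p ∘ₗ (IsScalarTower.toAlgHom F A (Localization.AtPrime p.asIdeal)).toLinearMap,
    fun x hx ↦ PrimeSpectrum.toPiLocalization_injective A (funext fun p ↦ ?_)⟩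
  refine (hφ p _ fun y ↦ ?_).trans (map_zero (algebraMap A _)).symm
  obtain ⟨a, ha⟩ := PrimeSpectrum.toPiLocalization_bijective.2 (Pi.single p y)
  have ha' (p' : PrimeSpectrum A) : algebraMap A (Localization.AtPrime p'.asIdeal) a =
      (Pi.single p y : PrimeSpectrum.PiLocalization A) p' := congrFun ha p'
  have := hx a
  rw [LinearMap.sum_apply, Finset.sum_eq_single p] at this
  · simpa [ha'] using! this
  · intro p' _ hp'
    simp [ha', Pi.single_eq_of_ne hp']
  · simp

/-- For a commutative noetherian local ring `(P, 𝔭, k)` and a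
homomorphism of commutative rings `P → Q`, the following are equivalent:
(i) the `P`-algebra `Q` is Frobenius;
(ii) `P' ⊗_P Q` is a Frobenius `P'`-algebra for every local ring `P'` under `P`;
(iii) `Q` is finite free over `P` and `k(q) ⊗_P Q` is Gorenstein for every prime `q`;
(iv) `Q` is finite free over `P` and `Q/𝔭Q` is Gorenstein. -/
theorem isFrobeniusAlgebra_iff_baseChange_iff_gorenstein_fibers
    (P Q : Type) [CommRing P] [IsNoetherianRing P] [IsLocalRing P]
    [CommRing Q] [Algebra P Q] :
    (IsFrobeniusAlgebra P Q ↔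
      ∀ (P' : Type) (iP' : CommRing P'),
        letI := iP'
        ∀ (_ : IsLocalRing P') (f : P →+* P'),
          letI := f.toAlgebra
          IsFrobeniusAlgebra P' (P' ⊗[P] Q)) ∧
    (IsFrobeniusAlgebra P Q ↔
      (Module.Finite P Q ∧ Module.Free P Q ∧
        ∀ (q : Ideal P) (hq : q.IsPrime),
          letI := hq
          IsGorensteinRing ((IsLocalRing.ResidueField (Localization.AtPrime q)) ⊗[P] Q))) ∧
    (IsFrobeniusAlgebra P Q ↔
      (Module.Finite P Q ∧ Module.Free P Q ∧
        IsGorensteinRing (Q ⧸ (IsLocalRing.maximalIdeal P).map (algebraMap P Q)))) := by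
  refine ⟨⟨fun h P' _ _ f ↦ ?_, fun h ↦ ?_⟩, ⟨fun h ↦ ⟨h.1, h.2.1, fun q hq ↦ ?_⟩, ?_⟩,
    ⟨fun h ↦ ⟨h.1, h.2.1, ?_⟩, ?_⟩⟩
  · let := f.toAlgebra
    exact h.baseChange P'
  · have h' : IsFrobeniusAlgebra P (P ⊗[P] Q) := h P inferInstance inferInstance (RingHom.id P)
    have := h'.1
    have := h'.2.1
    have := Module.Finite.equiv (TensorProduct.lid P Q)
    have := Module.Free.of_equiv (TensorProduct.lid P Q)
    exact h'.of_baseChange_of_surjective Function.surjective_id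
  · exact (h.baseChange _).isGorensteinRing
  · rintro ⟨_, _, h⟩
    exact IsFrobeniusAlgebra.of_baseChange_of_surjective
      (IsLocalRing.maximalIdeal P).algebraMap_residueField_surjective
      (h (IsLocalRing.maximalIdeal P) inferInstance).isFrobeniusAlgebra
  · have := h.1
    have := h.2.1
    let b := Module.Free.chooseBasis P Q
    let := Ideal.Quotient.field (IsLocalRing.maximalIdeal P)
    have h' : IsFrobeniusAlgebra (P ⧸ IsLocalRing.maximalIdeal P)
        (Q ⧸ (IsLocalRing.maximalIdeal P).map (algebraMap P Q)) :=
      h.of_basis_map (Ideal.Quotient.mk _) (Ideal.Quotient.mk _) (fun c x ↦ by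
        simp [Algebra.smul_def]) b
        (IsLocalRing.basisQuotient b) (IsLocalRing.basisQuotient_apply b)
    exact h'.isGorensteinRing
  · rintro ⟨_, _, h⟩
    let b := Module.Free.chooseBasis P Q
    let := Ideal.Quotient.field (IsLocalRing.maximalIdeal P)
    have h' : IsFrobeniusAlgebra (P ⧸ IsLocalRing.maximalIdeal P)
        (Q ⧸ (IsLocalRing.maximalIdeal P).map (algebraMap P Q)) := by
      have := Module.Finite.of_basis (IsLocalRing.basisQuotient b)
      exact h.isFrobeniusAlgebra
    have := IsLocalHom.of_surjective (Ideal.Quotient.mk (IsLocalRing.maximalIdeal P))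
      Ideal.Quotient.mk_surjective
    exact h'.of_surjective (Ideal.Quotient.mk _) Ideal.Quotient.mk_surjective
      (Ideal.Quotient.mk _) (fun c x ↦ by simp [Algebra.smul_def])
      b (IsLocalRing.basisQuotient b) (IsLocalRing.basisQuotient_apply b)
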